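/- For all t ≥ 0 and 0 ≤ s ≤ e^{1/4}, one has s·t ≤ (e^{t²} − 1) + s²/2. -/

import Mathlib

theorem stmt_1 (s t : ℝ) (ht : 0 ≤ t) (hs0 : 0 ≤ s) (hs : s ≤ Real.exp (1/4)) :
    s * t ≤ (Real.exp (t ^ 2) - 1) + s ^ 2 / 2 := by
  have h := Real.add_one_le_exp (t ^ 2)
  nlinarith [sq_nonneg (s - t), sq_nonneg t]
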